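/- Let G be a finite group acting linearly on ℝ^n and hence on ℝ[X_1, …, X_n], and let ℝ[X]_{≤ d} = ⊕_{j=1}^{l} ⊕_{u=1}^{η_j} W_{j,u} be a decomposition into irreducible G-submodules, where for each j the W_{j,u} are pairwise isomorphic to an irreducible representation W_j, the W_j for distinct j are non-isomorphic, and each W_j remains irreducible over ℂ; let f_{j1}, …, f_{jη_j} be polynomials such that the G-span of f_{j1} equals W_{j,1} and f_{ju} is the image of f_{j1} under the G-isomorphism W_{j,1} → W_{j,u}. Define for each j the symmetric matrix polynomial B^{(j)} with entries B^{(j)}_{u,v} := Σ_{g ∈ G} f_{ju}^g · f_{jv}^g. Then a G-invariant polynomial g of degree at most 2d is a sum of squares if and only if g = ⟨A_1, B^{(1)}⟩ + … + ⟨A_l, B^{(l)}⟩ for some positive semidefinite real symmetric matrices A_j of size η_j × η_j, where ⟨A, B⟩ denotes Σ_{u,v} A_{u,v} B_{u,v}. -/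

import Mathlib

open MvPolynomial

set_option synthInstance.maxHeartbeats 1000000
set_option maxHeartbeats 1000000

/-- The action of an invertible matrix `M` on polynomials by linear change of variables:
`X_i ↦ Σ_j M i j • X_j`. -/
noncomputable def polyAct {K : Type*} [CommSemiring K] {n : ℕ}
    (M : Matrix (Fin n) (Fin n) K) :
    MvPolynomial (Fin n) K →ₐ[K] MvPolynomial (Fin n) K :=
  MvPolynomial.aeval (fun i => ∑ j, M i j • MvPolynomial.X j)


theorem aux_inv_form {V G : Type*} [AddCommGroup V] [Module ℝ V] [Group G] [Fintype G]
    (a : G → V →ₗ[ℝ] V) (a1 : ∀ v, a 1 v = v) (amul : ∀ g h v, a g (a h v) = a (g * h) v)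
    (U : Submodule ℝ V) [FiniteDimensional ℝ U] :
    ∃ B : V →ₗ[ℝ] V →ₗ[ℝ] ℝ, (∀ p q, B p q = B q p) ∧ (∀ p, 0 ≤ B p p) ∧
      (∀ p ∈ U, B p p = 0 → p = 0) ∧ (∀ g p q, B (a g p) (a g q) = B p q) := by
  obtain ⟨π, hπ⟩ := U.subtype.exists_leftInverse_of_injective U.ker_subtype
  let e := Module.finBasis ℝ U
  let c : Fin _ → V →ₗ[ℝ] ℝ := fun k => (e.coord k).comp π
  let B : V →ₗ[ℝ] V →ₗ[ℝ] ℝ := ∑ g : G, ∑ k,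
    (LinearMap.mul ℝ ℝ).compl₁₂ ((c k).comp (a g)) ((c k).comp (a g))
  have hB : ∀ p q, B p q = ∑ g : G, ∑ k, c k (a g p) * c k (a g q) := by
    intro p q; simp [B]
  refine ⟨B, ?_, ?_, ?_, ?_⟩
  · intro p q; simp only [hB, mul_comm]
  · intro p; rw [hB]
    exact Finset.sum_nonneg fun g _ => Finset.sum_nonneg fun k _ => mul_self_nonneg _
  · intro p hp h
    rw [hB, Finset.sum_eq_zero_iff_of_nonneg
      (fun g _ => Finset.sum_nonneg fun k _ => mul_self_nonneg _)] at h
    have h1 := h 1 (Finset.mem_univ _)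
    rw [Finset.sum_eq_zero_iff_of_nonneg (fun k _ => mul_self_nonneg _)] at h1
    have h2 : ∀ k, e.coord k (π p) = 0 := by
      intro k
      have := h1 k (Finset.mem_univ _)
      rw [a1] at this
      exact mul_self_eq_zero.mp this
    have h3 : π p = 0 := e.forall_coord_eq_zero_iff.mp h2
    have h4 : π p = ⟨p, hp⟩ := LinearMap.congr_fun hπ ⟨p, hp⟩
    rw [h4] at h3
    exact congrArg Subtype.val h3
  · intro g p q
    simp only [hB, amul]
    exact Fintype.sum_equiv (Equiv.mulRight g) _ _ (fun x => rfl)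

theorem aux_riesz {V G : Type*} [AddCommGroup V] [Module ℝ V] [Group G]
    (a : G → V →ₗ[ℝ] V) (a1 : ∀ v, a 1 v = v) (amul : ∀ g h v, a g (a h v) = a (g * h) v)
    (U W W' : Submodule ℝ V) [FiniteDimensional ℝ U] (hU : W' ≤ U)
    (B : V →ₗ[ℝ] V →ₗ[ℝ] ℝ)
    (hpos : ∀ p ∈ U, B p p = 0 → p = 0) (hinv : ∀ g p q, B (a g p) (a g q) = B p q)
    (hW' : ∀ g, ∀ p ∈ W', a g p ∈ W')
    (β : V →ₗ[ℝ] V →ₗ[ℝ] ℝ)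
    (hβ : ∀ g, ∀ p ∈ W, ∀ q ∈ W', β (a g p) (a g q) = β p q) :
    ∃ ψ : V →ₗ[ℝ] V, (∀ p, ψ p ∈ W') ∧ (∀ g, ∀ p ∈ W, ψ (a g p) = a g (ψ p)) ∧
      ∀ p, ∀ q ∈ W', β p q = B (ψ p) q := by
  have : FiniteDimensional ℝ W' := Submodule.finiteDimensional_of_le hU
  let B' : LinearMap.BilinForm ℝ W' := B.compl₁₂ W'.subtype W'.subtype
  have hB'nd : B'.Nondegenerate := by
    constructor
    · intro x hx
      exact Subtype.ext (hpos x (hU x.2) (hx x))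
    · intro x hx
      exact Subtype.ext (hpos x (hU x.2) (hx x))
  let ψ : V →ₗ[ℝ] V := W'.subtype.comp
    ((B'.toDual hB'nd).symm.toLinearMap.comp (β.compl₁₂ LinearMap.id W'.subtype))
  have h1 : ∀ p, ψ p ∈ W' := fun p => Subtype.coe_prop _
  have h2 : ∀ p, ∀ q ∈ W', β p q = B (ψ p) q := by
    intro p q hq
    exact (LinearMap.BilinForm.apply_toDual_symm_apply (hB := hB'nd)
      (β.compl₁₂ LinearMap.id W'.subtype p) ⟨q, hq⟩).symm
  refine ⟨ψ, h1, ?_, h2⟩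
  intro g p hp
  have hd : ψ (a g p) - a g (ψ p) ∈ W' := W'.sub_mem (h1 _) (hW' _ _ (h1 _))
  have key : ∀ q ∈ W', B (ψ (a g p) - a g (ψ p)) q = 0 := by
    intro q hq
    have hq' : q = a g (a g⁻¹ q) := by rw [amul, mul_inv_cancel, a1]
    rw [map_sub, LinearMap.sub_apply, ← h2 _ _ hq]
    rw [hq', hβ g p hp _ (hW' _ _ hq), hinv, h2 _ _ (hW' _ _ hq), sub_self]
  exact sub_eq_zero.mp (hpos _ (hU hd) (key _ hd))

theorem aux_schur_bij {V G : Type*} [AddCommGroup V] [Module ℝ V]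
    (a : G → V →ₗ[ℝ] V)
    (W W' : Submodule ℝ V)
    (hW : ∀ g, ∀ p ∈ W, a g p ∈ W)
    (hirr : ∀ U : Submodule ℝ V, U ≤ W → (∀ g, ∀ q ∈ U, a g q ∈ U) → U = ⊥ ∨ U = W)
    (hirr' : ∀ U : Submodule ℝ V, U ≤ W' → (∀ g, ∀ q ∈ U, a g q ∈ U) → U = ⊥ ∨ U = W')
    (ψ : V →ₗ[ℝ] V) (h1 : ∀ p, ψ p ∈ W') (h2 : ∀ g, ∀ p ∈ W, ψ (a g p) = a g (ψ p)) :
    (∀ p ∈ W, ψ p = 0) ∨ Set.BijOn ψ W W' := by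
  rcases hirr (W ⊓ LinearMap.ker ψ) inf_le_left (by
    rintro g q ⟨hq, hk⟩
    refine ⟨hW _ _ hq, ?_⟩
    have hk' : ψ q = 0 := hk
    change ψ (a g q) = 0
    rw [h2 g q hq, hk', map_zero]) with h | h
  · rcases hirr' (W.map ψ) (by rintro _ ⟨x, _, rfl⟩; exact h1 x) (by
      rintro g _ ⟨x, hx, rfl⟩
      exact ⟨a g x, hW _ _ hx, h2 g x hx⟩) with h' | h'
    · left
      intro p hp
      have : ψ p ∈ W.map ψ := ⟨p, hp, rfl⟩
      rw [h'] at this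
      exact this
    · right
      refine ⟨fun p _ => h1 p, ?_, ?_⟩
      · intro x hx y hy hxy
        have : x - y ∈ W ⊓ LinearMap.ker ψ := ⟨W.sub_mem hx hy, by
          change ψ (x - y) = 0
          rw [map_sub, hxy, sub_self]⟩
        rw [h] at this
        exact sub_eq_zero.mp this
      · intro y hy
        have : y ∈ W.map ψ := by rw [h']; exact hy
        exact this
  · left
    intro p hp
    rw [← h] at hp
    exact hp.2

theorem aux_deg {n d l : ℕ} (s : Fin l → MvPolynomial (Fin n) ℝ)
    (h : (∑ t, (s t) ^ 2).totalDegree ≤ 2 * d) (t : Fin l) : (s t).totalDegree ≤ d := by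
  let m : MonomialOrder (Fin n) := MonomialOrder.degLex
  obtain ⟨t0, -, ht0⟩ := Finset.exists_max_image (Finset.univ : Finset (Fin l))
    (fun t => m.toSyn (m.degree (s t))) ⟨t, Finset.mem_univ _⟩
  set μ := m.degree (s t0) with hμ
  have hc : (∑ t, (s t) ^ 2).coeff (μ + μ) = ∑ t, (s t).coeff μ * (s t).coeff μ := by
    rw [MvPolynomial.coeff_sum]
    refine Finset.sum_congr rfl fun t _ => ?_
    rw [pow_two]
    exact m.coeff_mul_of_add_of_degree_le (ht0 t (Finset.mem_univ _)) (ht0 t (Finset.mem_univ _))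
  have hμd : μ.degree ≤ d := by
    by_cases h0 : s t0 = 0
    · rw [hμ, h0]; simp
    · have hpos : 0 < (∑ t, (s t) ^ 2).coeff (μ + μ) := by
        rw [hc]
        refine Finset.sum_pos' (fun _ _ => mul_self_nonneg _) ⟨t0, Finset.mem_univ _, ?_⟩
        exact mul_self_pos.mpr (m.leadingCoeff_ne_zero_iff.mpr h0)
      have := MvPolynomial.le_totalDegree (MvPolynomial.mem_support_iff.mpr hpos.ne')
      have h2 : (μ + μ).degree ≤ 2 * d := le_trans this h
      rw [map_add] at h2
      omega
  refine Finset.sup_le fun b hb => ?_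
  have h1 : m.toSyn b ≤ m.toSyn μ := (m.le_degree hb).trans (ht0 t (Finset.mem_univ _))
  have h2 : b.degree ≤ μ.degree := Finsupp.DegLex.monotone_degree h1
  exact h2.trans hμd

theorem aux_act_mul {n : ℕ} (M N : Matrix (Fin n) (Fin n) ℝ) (q : MvPolynomial (Fin n) ℝ) :
    polyAct M (polyAct N q) = polyAct (N * M) q := by
  have : (polyAct M).comp (polyAct N) = polyAct (N * M) := by
    apply MvPolynomial.algHom_ext
    intro i
    simp [polyAct, Matrix.mul_apply, Finset.smul_sum, smul_smul, Finset.sum_smul]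
    exact Finset.sum_comm
  exact AlgHom.congr_fun this q

theorem aux_act_one {n : ℕ} (q : MvPolynomial (Fin n) ℝ) :
    polyAct (1 : Matrix (Fin n) (Fin n) ℝ) q = q := by
  have : polyAct (1 : Matrix (Fin n) (Fin n) ℝ) = AlgHom.id ℝ _ := by
    apply MvPolynomial.algHom_ext
    intro i
    simp [polyAct, Matrix.one_apply]
  rw [this]; rfl

/-- **Symmetry-adapted sum-of-squares decomposition of invariant polynomials.**
Let the finite group `G` act linearly on `ℝ^n` (via `ρ`), hence on `ℝ[X_1,…,X_n]` by
`f^g := polyAct (ρ g⁻¹) f`.  Let `ℝ[X]_{≤d} = ⊕_{i ∈ I} ⊕_{j} W i j` be a decomposition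
into irreducible `G`-submodules, the `W i j` (for fixed `i`) pairwise `G`-isomorphic
(via maps `φ i j`), absolutely irreducible (every `G`-endomorphism is scalar, i.e.
they stay irreducible over `ℂ`), and non-isomorphic for distinct `i`; let `f i 0`
cyclically generate `W i 0` and `f i j = φ i j (f i 0)`.  Defining the matrix polynomials `B^{(i)}` with entries
`B^{(i)} u v = Σ_g (f i u)^g (f i v)^g`, a `G`-invariant polynomial `p` of degree at most
`2d` is a sum of squares if and only if `p = Σ_i ⟨A i, B^{(i)}⟩` for positive
semidefinite matrices `A i` of size `η i × η i`. -/
theorem invariant_sos_iff_psd_blocks {n d : ℕ} {G : Type*} [Group G] [Fintype G]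
    (ρ : G →* (Matrix (Fin n) (Fin n) ℝ)ˣ)
    {I : Type*} [Fintype I] (η : I → ℕ) [∀ i, NeZero (η i)]
    (W : (i : I) → Fin (η i) → Submodule ℝ (MvPolynomial (Fin n) ℝ))
    -- the `W i j` decompose the space of polynomials of degree at most `d`
    (hWle : ∀ i j, W i j ≤ restrictTotalDegree (Fin n) ℝ d)
    (hWindep : iSupIndep (fun p : Σ i : I, Fin (η i) => W p.1 p.2))
    (hWsup : (⨆ p : Σ i : I, Fin (η i), W p.1 p.2) = restrictTotalDegree (Fin n) ℝ d)
    -- each `W i j` is a `G`-stable irreducible submodule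
    (hWstab : ∀ i j (g : G), ∀ q ∈ W i j, polyAct (↑(ρ g⁻¹)) q ∈ W i j)
    (hWirr : ∀ i j, W i j ≠ ⊥ ∧ ∀ U : Submodule ℝ (MvPolynomial (Fin n) ℝ),
      U ≤ W i j → (∀ g : G, ∀ q ∈ U, polyAct (↑(ρ g⁻¹)) q ∈ U) → U = ⊥ ∨ U = W i j)
    -- each `W i j` remains irreducible over `ℂ`: `G`-endomorphisms are scalar
    (hWabs : ∀ i j, ∀ φ : MvPolynomial (Fin n) ℝ →ₗ[ℝ] MvPolynomial (Fin n) ℝ,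
      (∀ q ∈ W i j, φ q ∈ W i j) →
      (∀ g : G, ∀ q ∈ W i j, φ (polyAct (↑(ρ g⁻¹)) q) = polyAct (↑(ρ g⁻¹)) (φ q)) →
      ∃ c : ℝ, ∀ q ∈ W i j, φ q = c • q)
    -- for `i ≠ i'` the modules `W i j` and `W i' j'` are not `G`-isomorphic
    (hniso : ∀ i i', i ≠ i' → ∀ j j',
      ¬ ∃ φ : MvPolynomial (Fin n) ℝ →ₗ[ℝ] MvPolynomial (Fin n) ℝ,
        (∀ g : G, ∀ q ∈ W i j, φ (polyAct (↑(ρ g⁻¹)) q) = polyAct (↑(ρ g⁻¹)) (φ q)) ∧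
        Set.BijOn φ (W i j) (W i' j'))
    -- the polynomials `f i j`: `f i 0` cyclically generates `W i 0`, and `f i j` is its
    -- image under the `G`-isomorphism `φ i j : W i 0 → W i j`
    (f : (i : I) → Fin (η i) → MvPolynomial (Fin n) ℝ)
    (hfgen : ∀ i, Submodule.span ℝ {q | ∃ g : G, q = polyAct (↑(ρ g⁻¹)) (f i 0)} = W i 0)
    (φ : (i : I) → (j : Fin (η i)) →
      MvPolynomial (Fin n) ℝ →ₗ[ℝ] MvPolynomial (Fin n) ℝ)
    (hφ : ∀ i j, (∀ g : G, ∀ q ∈ W i 0,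
        (φ i j) (polyAct (↑(ρ g⁻¹)) q) = polyAct (↑(ρ g⁻¹)) ((φ i j) q)) ∧
      Set.BijOn (φ i j) (W i 0) (W i j) ∧ f i j = φ i j (f i 0)) :
    ∀ p : MvPolynomial (Fin n) ℝ,
    ∀ p : MvPolynomial (Fin n) ℝ,
      (∀ g : G, polyAct (↑(ρ g⁻¹)) p = p) →
      p.totalDegree ≤ 2 * d →
      ((∃ (l : ℕ) (s : Fin l → MvPolynomial (Fin n) ℝ), p = ∑ t, (s t) ^ 2) ↔
        ∃ A : (i : I) → Matrix (Fin (η i)) (Fin (η i)) ℝ,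
          (∀ i, (A i).PosSemidef) ∧
          p = ∑ i, ∑ u, ∑ v, A i u v •
            ∑ g : G, polyAct (↑(ρ g⁻¹)) (f i u) * polyAct (↑(ρ g⁻¹)) (f i v)) := by
  classical
  intro _ p hp hdeg
  -- the action as linear maps
  let a : G → MvPolynomial (Fin n) ℝ →ₗ[ℝ] MvPolynomial (Fin n) ℝ :=
    fun g => (polyAct (↑(ρ g⁻¹) : Matrix (Fin n) (Fin n) ℝ)).toLinearMap
  have ha : ∀ g q, polyAct (↑(ρ g⁻¹) : Matrix (Fin n) (Fin n) ℝ) q = a g q := fun g q => rfl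
  have a1 : ∀ v, a 1 v = v := by
    intro v
    rw [← ha, inv_one, map_one, Units.val_one, aux_act_one]
  have amul : ∀ g h v, a g (a h v) = a (g * h) v := by
    intro g h v
    rw [← ha, ← ha, ← ha, aux_act_mul, mul_inv_rev, map_mul, Units.val_mul]
  have amulp : ∀ g q r, a g (q * r) = a g q * a g r := by
    intro g q r
    rw [← ha, ← ha, ← ha, map_mul]
  simp only [ha] at *
  let T : MvPolynomial (Fin n) ℝ →ₗ[ℝ] MvPolynomial (Fin n) ℝ →ₗ[ℝ] MvPolynomial (Fin n) ℝ :=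
    ∑ g : G, (LinearMap.mul ℝ (MvPolynomial (Fin n) ℝ)).compl₁₂ (a g) (a g)
  have hT : ∀ q r, T q r = ∑ g : G, a g q * a g r := by
    intro q r; simp [T]
  have hTinv : ∀ g q r, T (a g q) (a g r) = T q r := by
    intro g q r
    simp only [hT, amul]
    exact Fintype.sum_equiv (Equiv.mulRight g) _ _ (fun x => rfl)
  simp only [← hT]
  constructor
  · rintro ⟨l, s, hs⟩
    have hsd : ∀ t, s t ∈ restrictTotalDegree (Fin n) ℝ d := by
      intro t
      rw [mem_restrictTotalDegree]
      exact aux_deg s (hs ▸ hdeg) t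
    obtain ⟨B, hBsymm, hBnn, hBpos, hBinv⟩ :=
      aux_inv_form a a1 amul (restrictTotalDegree (Fin n) ℝ d)
    -- off-diagonal blocks vanish
    have hoff : ∀ i i', i ≠ i' → ∀ j j', ∀ q ∈ W i j, ∀ r ∈ W i' j', T q r = 0 := by
      intro i i' hii j j' q hq r hr
      ext m
      obtain ⟨ψ, h1, h2, h3⟩ := aux_riesz a a1 amul (restrictTotalDegree (Fin n) ℝ d)
        (W i j) (W i' j') (hWle i' j') B hBpos hBinv (hWstab i' j')
        (T.compr₂ (lcoeff ℝ m)) (by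
          intro g p _ q _
          simp [hTinv])
      have h4 : ψ q = 0 := by
        rcases aux_schur_bij a (W i j) (W i' j') (hWstab i j) (hWirr i j).2 (hWirr i' j').2
          ψ h1 h2 with h | h
        · exact h q hq
        · exact absurd ⟨ψ, h2, h⟩ (hniso i i' hii j j')
      have h5 := h3 q r hr
      rw [h4, map_zero, LinearMap.zero_apply] at h5
      simpa using h5
    have hf0 : ∀ i, f i 0 ∈ W i 0 := by
      intro i
      rw [← hfgen i]
      exact Submodule.subset_span ⟨1, (a1 _).symm⟩
    have hfne : ∀ i, f i 0 ≠ 0 := by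
      intro i h0
      apply (hWirr i 0).1
      rw [← hfgen i, Submodule.span_eq_bot]
      rintro _ ⟨g, rfl⟩
      rw [h0, map_zero]
    have hBf : ∀ i, 0 < B (f i 0) (f i 0) := by
      intro i
      refine lt_of_le_of_ne (hBnn _) fun h => hfne i (hBpos _ (hWle i 0 (hf0 i)) h.symm)
    -- diagonal blocks
    have hdiag : ∀ i u v, ∀ q ∈ W i 0, ∀ r ∈ W i 0,
        T (φ i u q) (φ i v r) = ((B (f i 0) (f i 0))⁻¹ * B q r) • T (f i u) (f i v) := by
      intro i u v q hq r hr
      rw [(hφ i u).2.2, (hφ i v).2.2]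
      ext m
      obtain ⟨ψ, h1, h2, h3⟩ := aux_riesz a a1 amul (restrictTotalDegree (Fin n) ℝ d)
        (W i 0) (W i 0) (hWle i 0) B hBpos hBinv (hWstab i 0)
        ((T.compl₁₂ (φ i u) (φ i v)).compr₂ (lcoeff ℝ m)) (by
          intro g p hp q hq
          simp [(hφ i u).1 g p hp, (hφ i v).1 g q hq, hTinv])
      obtain ⟨c, hc⟩ := hWabs i 0 ψ (fun q _ => h1 q) h2
      have h5 := h3 q r hr
      have h6 := h3 (f i 0) (f i 0) (hf0 i)
      rw [hc q hq] at h5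
      rw [hc _ (hf0 i)] at h6
      simp only [LinearMap.compr₂_apply, LinearMap.compl₁₂_apply, lcoeff_apply, map_smul,
        LinearMap.smul_apply, smul_eq_mul] at h5 h6
      rw [coeff_smul, smul_eq_mul, h5, h6]
      have := (hBf i).ne'
      field_simp
    -- the orbit sum of one square
    have hone : ∀ q ∈ restrictTotalDegree (Fin n) ℝ d,
        ∃ A : (i : I) → Matrix (Fin (η i)) (Fin (η i)) ℝ, (∀ i, (A i).PosSemidef) ∧
          T q q = ∑ i, ∑ u, ∑ v, A i u v • T (f i u) (f i v) := by
      intro q hq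
      rw [← hWsup, Submodule.mem_iSup_iff_exists_finsupp] at hq
      obtain ⟨w, hw, hwq⟩ := hq
      rw [Finsupp.sum_fintype _ _ (fun _ => rfl), Fintype.sum_sigma] at hwq
      have hex : ∀ i u, ∃ c ∈ W i 0, φ i u c = w ⟨i, u⟩ := fun i u =>
        (hφ i u).2.1.surjOn (hw ⟨i, u⟩)
      choose c hc hcw using hex
      refine ⟨fun i => Matrix.of fun u v => (B (f i 0) (f i 0))⁻¹ * B (c i u) (c i v), ?_, ?_⟩
      · intro i
        refine Matrix.PosSemidef.of_dotProduct_mulVec_nonneg ?_ ?_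
        · ext u v
          simp [hBsymm (c i u) (c i v)]
        · intro x
          have : star x ⬝ᵥ (Matrix.of fun u v =>
              (B (f i 0) (f i 0))⁻¹ * B (c i u) (c i v)).mulVec x =
              (B (f i 0) (f i 0))⁻¹ * B (∑ u, x u • c i u) (∑ u, x u • c i u) := by
            simp only [dotProduct, Matrix.mulVec, map_sum, map_smul, LinearMap.sum_apply,
              LinearMap.smul_apply, smul_eq_mul, Finset.mul_sum, Matrix.of_apply, Pi.star_apply,
              star_trivial]
            rw [Finset.sum_comm]
            refine Finset.sum_congr rfl fun u _ => Finset.sum_congr rfl fun v _ => ?_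
            ring
          rw [this]
          exact mul_nonneg (inv_nonneg.mpr (hBf i).le) (hBnn _)
      · rw [← hwq]
        simp only [map_sum, LinearMap.sum_apply]
        refine Finset.sum_congr rfl fun i _ => ?_
        conv_rhs => rw [Finset.sum_comm]
        refine Finset.sum_congr rfl fun u _ => ?_
        rw [Finset.sum_eq_single i]
        · refine Finset.sum_congr rfl fun v _ => ?_
          rw [← hcw, ← hcw, hdiag i _ _ _ (hc i _) _ (hc i _)]
          simp
        · intro i' _ hi'
          refine Finset.sum_eq_zero fun v _ => ?_
          exact hoff i' i hi' _ _ _ (hw ⟨i', v⟩) _ (hw ⟨i, u⟩)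
        · intro h; exact absurd (Finset.mem_univ _) h
    choose A hA hAT using fun t => hone (s t) (hsd t)
    refine ⟨fun i => (Fintype.card G : ℝ)⁻¹ • ∑ t, A t i, ?_, ?_⟩
    · intro i
      exact (Matrix.posSemidef_sum _ (fun t _ => hA t i)).smul (by positivity)
    · have hcard : (Fintype.card G : ℝ) ≠ 0 := by
        exact_mod_cast Fintype.card_ne_zero
      have h1 : (Fintype.card G : ℝ) • p = ∑ t, T (s t) (s t) := by
        have : ∑ g : G, a g p = (Fintype.card G : ℝ) • p := by
          simp [hp, Nat.cast_smul_eq_nsmul]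
        rw [← this]
        simp only [hT]
        rw [Finset.sum_comm]
        refine Finset.sum_congr rfl fun g _ => ?_
        rw [hs, map_sum]
        refine Finset.sum_congr rfl fun t _ => ?_
        rw [pow_two, amulp]
      have h2 : p = (Fintype.card G : ℝ)⁻¹ • ∑ t, T (s t) (s t) := by
        rw [← h1, smul_smul, inv_mul_cancel₀ hcard, one_smul]
      rw [h2]
      simp only [hAT, Finset.smul_sum, Matrix.smul_apply, Matrix.sum_apply, Finset.sum_smul,
        smul_assoc]
      rw [Finset.sum_comm]
      refine Finset.sum_congr rfl fun i _ => ?_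
      rw [Finset.sum_comm]
      refine Finset.sum_congr rfl fun u _ => ?_
      rw [Finset.sum_comm]
  · rintro ⟨A, hA, hpA⟩
    have hC : ∀ i, ∃ C : Matrix (Fin (η i)) (Fin (η i)) ℝ, A i = C.conjTranspose * C := by
      intro i
      open scoped MatrixOrder in
      exact CStarAlgebra.nonneg_iff_eq_star_mul_self.mp (hA i).nonneg
    choose C hC using hC
    let S : (Σ i : I, G × Fin (η i)) → MvPolynomial (Fin n) ℝ :=
      fun x => ∑ u, C x.1 x.2.2 u • a x.2.1 (f x.1 u)
    have hS : p = ∑ x, (S x) ^ 2 := by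
      rw [hpA, Fintype.sum_sigma]
      refine Finset.sum_congr rfl fun i _ => ?_
      rw [Fintype.sum_prod_type]
      have hr : ∀ g k, S ⟨i, (g, k)⟩ ^ 2 =
          ∑ u, ∑ v, (C i k u * C i k v) • (a g (f i u) * a g (f i v)) := by
        intro g k
        simp only [S, pow_two, Finset.sum_mul_sum, smul_mul_smul_comm]
      simp only [hr, hT, hC, Matrix.mul_apply, Matrix.conjTranspose_apply, star_trivial,
        Finset.sum_smul, Finset.smul_sum]
      simp only [Finset.sum_comm (s := (Finset.univ : Finset (Fin (η i))))
        (t := (Finset.univ : Finset G))]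
      refine Finset.sum_congr rfl fun g _ => ?_
      rw [Finset.sum_comm_cycle]
    let e := Fintype.equivFin (Σ i : I, G × Fin (η i))
    refine ⟨_, fun t => S (e.symm t), ?_⟩
    rw [hS]
    exact (Equiv.sum_comp e.symm (fun x => S x ^ 2)).symm
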